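/- Let E be a finite-dimensional real inner product space and T : E → E a self-adjoint positive semidefinite linear operator. If u and v are nonzero elements of the range of T and equality ⟨u, T v⟩² = ⟨u, T u⟩ · ⟨v, T v⟩ holds in the Cauchy–Schwarz inequality for the semi-inner product induced by T, then u and v are linearly dependent (there exists a real scalar c with v = c • u). -/

import Mathlib

open RealInnerProductSpace

/-- An isotropic vector of a positive semidefinite symmetric operator lies in its kernel. -/
theorem map_eq_zero_of_inner_map_self_eq_zero
    {E : Type*} [NormedAddCommGroup E] [InnerProductSpace ℝ E] (T : E →ₗ[ℝ] E)
    (hsa : ∀ u v : E, ⟪T u, v⟫ = ⟪u, T v⟫) (hpsd : ∀ v : E, 0 ≤ ⟪v, T v⟫)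
    {w : E} (hw : ⟪w, T w⟫ = 0) : T w = 0 := by
  have key : ∀ s : ℝ,
      0 ≤ ⟪T w, T (T w)⟫ * (s * s) + (2 * ⟪T w, T w⟫) * s + 0 := fun s => by
    have h := hpsd (w + s • T w)
    simp only [map_add, map_smul, inner_add_left, inner_add_right, real_inner_smul_left,
      real_inner_smul_right, hw, ← hsa w (T w)] at h
    linarith
  have hd := discrim_le_zero key
  rw [discrim] at hd
  have h0 : ⟪T w, T w⟫ = 0 := by
    apply pow_eq_zero_iff (two_ne_zero) |>.mp
    nlinarith [sq_nonneg ⟪T w, T w⟫]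
  exact inner_self_eq_zero.mp h0

/-- A positive semidefinite symmetric operator is definite on its range. -/
theorem eq_zero_of_mem_range_of_inner_map_self_eq_zero
    {E : Type*} [NormedAddCommGroup E] [InnerProductSpace ℝ E] (T : E →ₗ[ℝ] E)
    (hsa : ∀ u v : E, ⟪T u, v⟫ = ⟪u, T v⟫) (hpsd : ∀ v : E, 0 ≤ ⟪v, T v⟫)
    {w : E} (hr : w ∈ LinearMap.range T) (hw : ⟪w, T w⟫ = 0) : w = 0 := by
  have hT := map_eq_zero_of_inner_map_self_eq_zero T hsa hpsd hw
  obtain ⟨y, rfl⟩ := hr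
  rw [← inner_self_eq_zero (𝕜 := ℝ), hsa, hT, inner_zero_right]

theorem semi_inner_cauchy_schwarz_equality
    {E : Type*} [NormedAddCommGroup E] [InnerProductSpace ℝ E]
    [FiniteDimensional ℝ E]
    (T : E →ₗ[ℝ] E)
    (hsa : ∀ u v : E, ⟪T u, v⟫ = ⟪u, T v⟫)
    (hpsd : ∀ v : E, 0 ≤ ⟪v, T v⟫)
    (u v : E) (hu : u ∈ LinearMap.range T) (hv : v ∈ LinearMap.range T)
    (hu0 : u ≠ 0) (hv0 : v ≠ 0)
    (heq : ⟪u, T v⟫ ^ 2 = ⟪u, T u⟫ * ⟪v, T v⟫) :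
    ∃ c : ℝ, v = c • u := by
  have ha : ⟪u, T u⟫ ≠ 0 := fun h =>
    hu0 (eq_zero_of_mem_range_of_inner_map_self_eq_zero T hsa hpsd hu h)
  have hvu : ⟪v, T u⟫ = ⟪u, T v⟫ := by rw [← hsa, real_inner_comm]
  have hw : ⟪u, T u⟫ • v - ⟪u, T v⟫ • u = 0 := by
    refine eq_zero_of_mem_range_of_inner_map_self_eq_zero T hsa hpsd
      (sub_mem (Submodule.smul_mem _ _ hv) (Submodule.smul_mem _ _ hu)) ?_
    simp only [map_sub, map_smul, inner_sub_left, inner_sub_right, real_inner_smul_left,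
      real_inner_smul_right, hvu]
    linear_combination -⟪u, T u⟫ * heq
  refine ⟨⟪u, T u⟫⁻¹ * ⟪u, T v⟫, ?_⟩
  rw [mul_smul, ← sub_eq_zero.mp hw, inv_smul_smul₀ ha]
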